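/- Existence and interim representation for the manipulator's backward recursion (core of Theorem 3): assume that for every stage n and every argument the interim solution sets (the sets of minimizers of the problems defining W^Y) are nonempty and compact in the weak topology. Then for each n = N−1,…,1 and each (x,y,a), the infimum defining W_{N−n}(x,y,a) over probability measures P ≪ λ⊗ν with Y-marginal Q^Y(·|x,y,a) is attained by some P_n*, and it satisfies W_{N−n}(x,y,a) = ∫_Y W^Y_{N−n}(y'; x,y,a) Q^Y(dy'|x,y,a). Likewise the infimum defining W_N is attained and W_N = ∫_Y W^Y_N(y; Q_0) Q_0^Y(dy), where W^Y_N is the corresponding interim problem with reference disintegration taken from Q_0. -/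

import Mathlib

open MeasureTheory
open scoped ENNReal NNReal

noncomputable section

namespace DIMG

/-- `L¹` distance of densities w.r.t. a reference measure `ρ` (twice total variation). -/
noncomputable def tvDist {Z : Type*} [MeasurableSpace Z] (ρ : Measure Z)
    (P P' : Measure Z) : ℝ :=
  ∫ z, |(P.rnDeriv ρ z).toReal - (P'.rnDeriv ρ z).toReal| ∂ρ

/-- Joint measure `P(dx,dy) = φ(dx|y) m(dy)` built from a `Y`-marginal and conditionals. -/
noncomputable def mixJoint {X Y : Type*} [MeasurableSpace X] [MeasurableSpace Y]
    (m : Measure Y) (φ : Y → Measure X) : Measure (X × Y) :=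
  m.bind fun y => (φ y).map fun x => (x, y)

/-- Data of the information manipulation problem: reference measures `lam, ν`; transition
density `q(x',y'|x,y,a)` (argument order `x' y' x y a`); initial density `q0(x,y)`; the
decision-maker's stage decision rules `g n : X → A`; manipulation cost `r`; discount `α`;
horizon `N`. -/
structure ManipSetting (X Y A : Type*) [MeasurableSpace X] [MeasurableSpace Y]
    [MeasurableSpace A] where
  lam : Measure X
  nu : Measure Y
  q : X → Y → X → Y → A → ℝ
  q0 : X → Y → ℝ
  g : ℕ → X → A
  r : X → Y → A → ℝ
  alpha : ℝ
  N : ℕ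

namespace ManipSetting

variable {X Y A : Type*} [MeasurableSpace X] [MeasurableSpace Y] [MeasurableSpace A]

/-- The transition kernel `Q(·,·|x,y,a)` as a measure with density `q` w.r.t. `λ⊗ν`. -/
noncomputable def Qm (M : ManipSetting X Y A) (x : X) (y : Y) (a : A) : Measure (X × Y) :=
  (M.lam.prod M.nu).withDensity fun p => ENNReal.ofReal (M.q p.1 p.2 x y a)

/-- The `Y`-marginal `Q^Y(·|x,y,a)`. -/
noncomputable def QY (M : ManipSetting X Y A) (x : X) (y : Y) (a : A) : Measure Y :=
  (M.Qm x y a).map Prod.snd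

/-- The initial reference measure `Q_0` with density `q0`. -/
noncomputable def Q0m (M : ManipSetting X Y A) : Measure (X × Y) :=
  (M.lam.prod M.nu).withDensity fun p => ENNReal.ofReal (M.q0 p.1 p.2)

/-- The `Y`-marginal `Q_0^Y` of `Q_0`. -/
noncomputable def Q0Y (M : ManipSetting X Y A) : Measure Y := M.Q0m.map Prod.snd

/-- Stagewise consistency at a stage `n ≥ 1` given the previous `(x,y,a)`: `P` is a
probability measure, `P ≪ λ⊗ν`, and the `Y`-marginal of `P` equals `Q^Y(·|x,y,a)`. -/
def Feas (M : ManipSetting X Y A) (x : X) (y : Y) (a : A) (P : Measure (X × Y)) : Prop :=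
  IsProbabilityMeasure P ∧ P ≪ M.lam.prod M.nu ∧ P.map Prod.snd = M.QY x y a

/-- Stagewise consistency at stage `0`. -/
def Feas0 (M : ManipSetting X Y A) (P : Measure (X × Y)) : Prop :=
  IsProbabilityMeasure P ∧ P ≪ M.lam.prod M.nu ∧ P.map Prod.snd = M.Q0Y

/-- The ex ante backward recursion `W`: `W_0 := 0` and, for `j = N−n` (stage `n = N−j`),
`W_j(x,y,a) := inf over stagewise consistent P of
  [α^n (∫ r(x',y',ĝ_n(x')) dP + ∫|dP − dQ(·,·|x,y,a)|) + ∫ W_{j−1}(x',y',ĝ_n(x')) dP]`. -/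
noncomputable def Wrec (M : ManipSetting X Y A) : ℕ → X → Y → A → ℝ
  | 0, _, _, _ => 0
  | j + 1, x, y, a =>
      ⨅ P : {P : Measure (X × Y) // M.Feas x y a P},
        M.alpha ^ (M.N - (j + 1)) *
            ((∫ p, M.r p.1 p.2 (M.g (M.N - (j + 1)) p.1) ∂(P : Measure (X × Y)))
              + tvDist (M.lam.prod M.nu) (P : Measure (X × Y)) (M.Qm x y a))
          + ∫ p, Wrec M j p.1 p.2 (M.g (M.N - (j + 1)) p.1) ∂(P : Measure (X × Y))

/-- Objective of the stage problem defining `W_j(x,y,a)` (for `j ≥ 1`). -/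
noncomputable def stageObj (M : ManipSetting X Y A) (j : ℕ) (x : X) (y : Y) (a : A)
    (P : Measure (X × Y)) : ℝ :=
  M.alpha ^ (M.N - j) *
      ((∫ p, M.r p.1 p.2 (M.g (M.N - j) p.1) ∂P)
        + tvDist (M.lam.prod M.nu) P (M.Qm x y a))
    + ∫ p, M.Wrec (j - 1) p.1 p.2 (M.g (M.N - j) p.1) ∂P

/-- Objective of the stage-`0` problem defining `W_N`. -/
noncomputable def stage0Obj (M : ManipSetting X Y A) (P : Measure (X × Y)) : ℝ :=
  (∫ p, M.r p.1 p.2 (M.g 0 p.1) ∂P) + tvDist (M.lam.prod M.nu) P M.Q0m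
    + ∫ p, M.Wrec (M.N - 1) p.1 p.2 (M.g 0 p.1) ∂P

/-- The top value `W_N` of the backward recursion. -/
noncomputable def WNval (M : ManipSetting X Y A) : ℝ :=
  ⨅ P : {P : Measure (X × Y) // M.Feas0 P}, M.stage0Obj (P : Measure (X × Y))

/-- Objective of the interim stage problem defining `W^Y_j(y'; x,y,a)` (for `j ≥ 1`), where
`ψ` is the disintegration kernel of `Q(·,·|x,y,a)` over `Q^Y(·|x,y,a)`. -/
noncomputable def interimObj (M : ManipSetting X Y A) (ψ : X → Y → A → Y → Measure X)
    (j : ℕ) (y' : Y) (x : X) (y : Y) (a : A) (η : Measure X) : ℝ :=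
  M.alpha ^ (M.N - j) *
      ((∫ x', M.r x' y' (M.g (M.N - j) x') ∂η) + tvDist M.lam η (ψ x y a y'))
    + ∫ x', M.Wrec (j - 1) x' y' (M.g (M.N - j) x') ∂η

/-- The interim stage value `W^Y_j(y'; x,y,a)`,
`inf over η ∈ P(X), η ≪ λ of interimObj`. -/
noncomputable def WYval (M : ManipSetting X Y A) (ψ : X → Y → A → Y → Measure X)
    (j : ℕ) (y' : Y) (x : X) (y : Y) (a : A) : ℝ :=
  ⨅ η : {η : Measure X // IsProbabilityMeasure η ∧ η ≪ M.lam},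
    M.interimObj ψ j y' x y a (η : Measure X)

/-- Objective of the interim problem at stage `0` with reference disintegration `ψ0` of
`Q_0` over `Q_0^Y`. -/
noncomputable def interim0Obj (M : ManipSetting X Y A) (ψ0 : Y → Measure X) (y : Y)
    (η : Measure X) : ℝ :=
  (∫ x', M.r x' y (M.g 0 x') ∂η) + tvDist M.lam η (ψ0 y)
    + ∫ x', M.Wrec (M.N - 1) x' y (M.g 0 x') ∂η

/-- The interim value `W^Y_N(y; Q_0)` at stage `0`. -/
noncomputable def WY0val (M : ManipSetting X Y A) (ψ0 : Y → Measure X) (y : Y) : ℝ :=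
  ⨅ η : {η : Measure X // IsProbabilityMeasure η ∧ η ≪ M.lam},
    M.interim0Obj ψ0 y (η : Measure X)

end ManipSetting

/-- Standing hypotheses on a manipulation setting. -/
structure ManipHyps {X Y A : Type*} [MeasurableSpace X] [MeasurableSpace Y]
    [MeasurableSpace A] (M : ManipSetting X Y A) : Prop where
  lam_prob : IsProbabilityMeasure M.lam
  nu_prob : IsProbabilityMeasure M.nu
  q_meas : Measurable fun p : X × Y × X × Y × A => M.q p.1 p.2.1 p.2.2.1 p.2.2.2.1 p.2.2.2.2
  q_nonneg : ∀ x' y' x y a, 0 ≤ M.q x' y' x y a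
  q_bdd : ∃ C : ℝ, ∀ x' y' x y a, M.q x' y' x y a ≤ C
  q_dens : ∀ x y a, ∫⁻ p : X × Y, ENNReal.ofReal (M.q p.1 p.2 x y a) ∂(M.lam.prod M.nu) = 1
  q0_meas : Measurable fun p : X × Y => M.q0 p.1 p.2
  q0_nonneg : ∀ x y, 0 ≤ M.q0 x y
  q0_dens : ∫⁻ p : X × Y, ENNReal.ofReal (M.q0 p.1 p.2) ∂(M.lam.prod M.nu) = 1
  g_meas : ∀ n, Measurable (M.g n)
  r_meas : Measurable fun p : X × Y × A => M.r p.1 p.2.1 p.2.2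
  r_nonneg : ∀ x y a, 0 ≤ M.r x y a
  r_bdd : ∃ C : ℝ, ∀ x y a, M.r x y a ≤ C
  alpha_pos : 0 < M.alpha
  alpha_lt_one : M.alpha < 1
  N_pos : 1 ≤ M.N

/-- `ψ` is a family of disintegration kernels of `Q(·,·|x,y,a)` over `Q^Y(·|x,y,a)` and
`ψ0` one of `Q_0` over `Q_0^Y`. -/
structure DisintHyps {X Y A : Type*} [MeasurableSpace X] [MeasurableSpace Y]
    [MeasurableSpace A] (M : ManipSetting X Y A) (ψ : X → Y → A → Y → Measure X)
    (ψ0 : Y → Measure X) : Prop where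
  ψ_meas : ∀ x y a, Measurable (ψ x y a)
  ψ_prob : ∀ x y a y', IsProbabilityMeasure (ψ x y a y')
  ψ_ac : ∀ x y a y', ψ x y a y' ≪ M.lam
  ψ_dis : ∀ x y a, M.Qm x y a = mixJoint (M.QY x y a) (ψ x y a)
  ψ0_meas : Measurable ψ0
  ψ0_prob : ∀ y, IsProbabilityMeasure (ψ0 y)
  ψ0_ac : ∀ y, ψ0 y ≪ M.lam
  ψ0_dis : M.Q0m = mixJoint M.Q0Y ψ0

/-- The interim solution sets, as subsets of `P(X)` (with the weak topology). -/
def interimSolSet {X Y A : Type*} [MeasurableSpace X] [MeasurableSpace Y] [MeasurableSpace A]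
    (M : ManipSetting X Y A) (ψ : X → Y → A → Y → Measure X)
    (j : ℕ) (y' : Y) (x : X) (y : Y) (a : A) : Set (ProbabilityMeasure X) :=
  {η : ProbabilityMeasure X | (η : Measure X) ≪ M.lam ∧
    M.interimObj ψ j y' x y a (η : Measure X) = M.WYval ψ j y' x y a}

/-- The interim solution set of the stage-`0` problem. -/
def interim0SolSet {X Y A : Type*} [MeasurableSpace X] [MeasurableSpace Y] [MeasurableSpace A]
    (M : ManipSetting X Y A) (ψ0 : Y → Measure X) (y : Y) : Set (ProbabilityMeasure X) :=
  {η : ProbabilityMeasure X | (η : Measure X) ≪ M.lam ∧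
    M.interim0Obj ψ0 y (η : Measure X) = M.WY0val ψ0 y}

open ProbabilityTheory

section Penalized

variable {Z : Type*} [MeasurableSpace Z]

theorem integrable_of_abs_le {μ : Measure Z} [IsFiniteMeasure μ] {f : Z → ℝ} {C : ℝ}
    (hf : Measurable f) (hC : ∀ z, |f z| ≤ C) : Integrable f μ :=
  Integrable.of_bound hf.aestronglyMeasurable C (ae_of_all _ hC)

theorem abs_integral_le_of_abs_le {μ : Measure Z} [IsProbabilityMeasure μ] {f : Z → ℝ} {C : ℝ}
    (hC : ∀ z, |f z| ≤ C) : |∫ z, f z ∂μ| ≤ C := by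
  simpa using norm_integral_le_of_norm_le_const (μ := μ) (f := f) (ae_of_all _ hC)

/-- The cost of `P` when deviations from `Q` are penalized at rate `c`. -/
def penObj (ρ : Measure Z) (c : ℝ) (f : Z → ℝ) (Q P : Measure Z) : ℝ :=
  ∫ z, f z ∂P + c * tvDist ρ P Q

/-- The nonnegative density of the optimality gap of `P` against the lower bound
`∫ min (f, k + 2c) dR`. -/
def gapDensity (ρ : Measure Z) (c : ℝ) (f k : Z → ℝ) (Q P : Measure Z) (z : Z) : ℝ :=
  (P.rnDeriv ρ z).toReal * f z
    + c * |(P.rnDeriv ρ z).toReal - (Q.rnDeriv ρ z).toReal|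
    - (Q.rnDeriv ρ z).toReal * min (f z) (k z + 2 * c)
    - ((P.rnDeriv ρ z).toReal * (k z + c) - (Q.rnDeriv ρ z).toReal * (k z + c))

theorem gapDensity_nonneg {ρ : Measure Z} {c : ℝ} {f k : Z → ℝ} {Q P : Measure Z}
    {z : Z} (hkf : k z ≤ f z) : 0 ≤ gapDensity ρ c f k Q P z := by
  unfold gapDensity
  have hu : 0 ≤ (P.rnDeriv ρ z).toReal := ENNReal.toReal_nonneg
  have hv : 0 ≤ (Q.rnDeriv ρ z).toReal := ENNReal.toReal_nonneg
  generalize (P.rnDeriv ρ z).toReal = u at *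
  generalize (Q.rnDeriv ρ z).toReal = v at *
  have h1 : min (f z) (k z + 2 * c) ≤ f z := min_le_left _ _
  have h2 : min (f z) (k z + 2 * c) ≤ k z + 2 * c := min_le_right _ _
  rcases le_total v u with h | h
  · rw [abs_of_nonneg (sub_nonneg.2 h)]
    nlinarith [mul_nonneg (sub_nonneg.2 hkf) (sub_nonneg.2 h), mul_nonneg hv (sub_nonneg.2 h1)]
  · rw [abs_of_nonpos (sub_nonpos.2 h)]
    nlinarith [mul_nonneg (sub_nonneg.2 h2) (sub_nonneg.2 h), mul_nonneg hu (sub_nonneg.2 h1)]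

theorem measurable_min_add {f k : Z → ℝ} (hf : Measurable f) (hk : Measurable k) (c : ℝ) :
    Measurable fun z => min (f z) (k z + 2 * c) :=
  hf.min (hk.add_const _)

theorem abs_min_add_le {a b c C : ℝ} (hc : 0 ≤ c) (ha : |a| ≤ C) (hb : |b| ≤ C) :
    |min a (b + 2 * c)| ≤ C := by
  rw [abs_le] at *
  exact ⟨le_min ha.1 (by linarith), (min_le_left _ _).trans ha.2⟩

theorem integrable_gapDensity_and_integral {ρ Q P : Measure Z} [SigmaFinite ρ]
    [IsProbabilityMeasure Q] [IsProbabilityMeasure P] (hQ : Q ≪ ρ) (hP : P ≪ ρ)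
    {c C : ℝ} (hc : 0 ≤ c) {f k : Z → ℝ} (hf : Measurable f) (hk : Measurable k)
    (hfC : ∀ z, |f z| ≤ C) (hkC : ∀ z, |k z| ≤ C) (hPQ : ∫ z, k z ∂P = ∫ z, k z ∂Q) :
    Integrable (gapDensity ρ c f k Q P) ρ ∧ ∫ z, gapDensity ρ c f k Q P z ∂ρ
      = penObj ρ c f Q P - ∫ z, min (f z) (k z + 2 * c) ∂Q := by
  have ih : Integrable (fun z => min (f z) (k z + 2 * c)) Q :=
    integrable_of_abs_le (measurable_min_add hf hk c) fun z => abs_min_add_le hc (hfC z) (hkC z)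
  have ikP : Integrable (fun z => k z + c) P :=
    (integrable_of_abs_le hk hkC).add (integrable_const _)
  have ikR : Integrable (fun z => k z + c) Q :=
    (integrable_of_abs_le hk hkC).add (integrable_const _)
  have i1 := (integrable_rnDeriv_smul_iff hP).2 (integrable_of_abs_le (μ := P) hf hfC)
  have i2 : Integrable (fun z => c * |(P.rnDeriv ρ z).toReal - (Q.rnDeriv ρ z).toReal|) ρ :=
    ((Measure.integrable_toReal_rnDeriv.sub Measure.integrable_toReal_rnDeriv).abs).const_mul c
  have i3 := (integrable_rnDeriv_smul_iff hQ).2 ih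
  have i4 := (integrable_rnDeriv_smul_iff hP).2 ikP
  have i5 := (integrable_rnDeriv_smul_iff hQ).2 ikR
  have e1 := integral_rnDeriv_smul (f := f) hP
  have e3 := integral_rnDeriv_smul (f := fun z => min (f z) (k z + 2 * c)) hQ
  have e4 := integral_rnDeriv_smul (f := fun z => k z + c) hP
  have e5 := integral_rnDeriv_smul (f := fun z => k z + c) hQ
  simp only [smul_eq_mul] at i1 i3 i4 i5 e1 e3 e4 e5
  refine ⟨((i1.add i2).sub i3).sub (i4.sub i5), ?_⟩
  unfold gapDensity
  refine (integral_sub ((i1.add i2).sub i3) (i4.sub i5)).trans ?_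
  rw [integral_sub' (i1.add i2) i3, integral_add' i1 i2, integral_sub' i4 i5,
    integral_const_mul, e1, e3, e4, e5,
    integral_add (integrable_of_abs_le hk hkC) (integrable_const _),
    integral_add (integrable_of_abs_le hk hkC) (integrable_const _), hPQ, penObj, tvDist]
  simp

theorem integral_min_le_penObj {ρ Q P : Measure Z} [SigmaFinite ρ]
    [IsProbabilityMeasure Q] [IsProbabilityMeasure P] (hQ : Q ≪ ρ) (hP : P ≪ ρ)
    {c C : ℝ} (hc : 0 ≤ c) {f k : Z → ℝ} (hf : Measurable f) (hk : Measurable k)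
    (hfC : ∀ z, |f z| ≤ C) (hkC : ∀ z, |k z| ≤ C) (hPQ : ∫ z, k z ∂P = ∫ z, k z ∂Q)
    (hkf : k ≤ᵐ[ρ] f) :
    ∫ z, min (f z) (k z + 2 * c) ∂Q ≤ penObj ρ c f Q P := by
  have h := (integrable_gapDensity_and_integral hQ hP hc hf hk hfC hkC hPQ).2
  have h0 : 0 ≤ ∫ z, gapDensity ρ c f k Q P z ∂ρ :=
    integral_nonneg_of_ae (hkf.mono fun z hz => gapDensity_nonneg hz)
  linarith

/-- If the lower bound is attained although `f > k` almost everywhere, then the truncation at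
`k + 2c` is not active. -/
theorem ae_le_of_penObj_eq {ρ Q P : Measure Z} [SigmaFinite ρ]
    [IsProbabilityMeasure Q] [IsProbabilityMeasure P] (hQ : Q ≪ ρ) (hP : P ≪ ρ)
    {c C : ℝ} (hc : 0 ≤ c) {f k : Z → ℝ} (hf : Measurable f) (hk : Measurable k)
    (hfC : ∀ z, |f z| ≤ C) (hkC : ∀ z, |k z| ≤ C) (hPQ : ∫ z, k z ∂P = ∫ z, k z ∂Q)
    (hkf : ∀ᵐ z ∂ρ, k z < f z)
    (heq : penObj ρ c f Q P = ∫ z, min (f z) (k z + 2 * c) ∂Q) :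
    ∀ᵐ z ∂Q, f z ≤ k z + 2 * c := by
  obtain ⟨hi, h⟩ := integrable_gapDensity_and_integral hQ hP hc hf hk hfC hkC hPQ
  rw [heq, sub_self, integral_eq_zero_iff_of_nonneg_ae
    (hkf.mono fun z hz => gapDensity_nonneg hz.le) hi] at h
  have huv : ∀ᵐ z ∂ρ, 0 ≤ (Q.rnDeriv ρ z).toReal - (P.rnDeriv ρ z).toReal := by
    filter_upwards [h, hkf] with z hz hlt
    by_contra! hcon
    have hv : 0 ≤ (Q.rnDeriv ρ z).toReal := ENNReal.toReal_nonneg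
    simp only [gapDensity, Pi.zero_apply] at hz
    generalize (P.rnDeriv ρ z).toReal = u at *
    generalize (Q.rnDeriv ρ z).toReal = v at *
    have h1 : min (f z) (k z + 2 * c) ≤ f z := min_le_left _ _
    rw [abs_of_pos (by linarith)] at hz
    nlinarith [mul_pos (sub_pos.2 hlt) (sub_pos.2 (sub_neg.1 hcon)),
      mul_nonneg hv (sub_nonneg.2 h1)]
  have hI : ∫ z, ((Q.rnDeriv ρ z).toReal - (P.rnDeriv ρ z).toReal) ∂ρ = 0 := by
    rw [integral_sub Measure.integrable_toReal_rnDeriv Measure.integrable_toReal_rnDeriv,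
      Measure.integral_toReal_rnDeriv hQ, Measure.integral_toReal_rnDeriv hP]
    simp
  rw [integral_eq_zero_iff_of_nonneg_ae huv (Measure.integrable_toReal_rnDeriv.sub
    Measure.integrable_toReal_rnDeriv)] at hI
  have hfR : Integrable f Q := integrable_of_abs_le hf hfC
  have hmR : Integrable (fun z => min (f z) (k z + 2 * c)) Q :=
    integrable_of_abs_le (measurable_min_add hf hk c) fun z => abs_min_add_le hc (hfC z) (hkC z)
  have h0 : ∫ z, (f z - min (f z) (k z + 2 * c)) ∂Q = 0 := by
    rw [← integral_rnDeriv_smul hQ]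
    refine integral_eq_zero_of_ae ?_
    filter_upwards [h, hI] with z hz hz'
    simp only [gapDensity, Pi.zero_apply] at hz hz'
    have : (P.rnDeriv ρ z).toReal = (Q.rnDeriv ρ z).toReal := by linarith
    rw [this, sub_self, abs_zero] at hz
    simp only [smul_eq_mul, Pi.zero_apply]
    linarith
  rw [integral_eq_zero_iff_of_nonneg_ae
    (ae_of_all _ fun z => sub_nonneg.2 (min_le_left _ _)) (hfR.sub hmR)] at h0
  filter_upwards [h0] with z hz
  simp only [Pi.zero_apply] at hz
  have := min_le_right (f z) (k z + 2 * c)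
  linarith

theorem tvDist_restrict_add_le {ρ Q T : Measure Z} [SigmaFinite ρ] [IsFiniteMeasure Q]
    [IsFiniteMeasure T] (hQ : Q ≪ ρ) (hT : T ≪ ρ) {G : Set Z} (hG : MeasurableSet G) :
    tvDist ρ (Q.restrict G + T) Q ≤ T.real Set.univ + Q.real Gᶜ := by
  have e1 := Measure.rnDeriv_add (Q.restrict G) T ρ
  have e2 := Measure.rnDeriv_add (Q.restrict G) (Q.restrict Gᶜ) ρ
  rw [Measure.restrict_add_restrict_compl hG] at e2
  have hRc : Q.restrict Gᶜ ≪ ρ := Measure.absolutelyContinuous_of_le Measure.restrict_le_self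
    |>.trans hQ
  have hm : Q.real Gᶜ = (Q.restrict Gᶜ).real Set.univ := by simp
  rw [hm, ← Measure.integral_toReal_rnDeriv hT, ← Measure.integral_toReal_rnDeriv hRc,
    ← integral_add Measure.integrable_toReal_rnDeriv Measure.integrable_toReal_rnDeriv, tvDist]
  refine integral_mono_ae (Measure.integrable_toReal_rnDeriv.sub
    Measure.integrable_toReal_rnDeriv).abs
    (Measure.integrable_toReal_rnDeriv.add Measure.integrable_toReal_rnDeriv) ?_
  filter_upwards [e1, e2, Measure.rnDeriv_lt_top (Q.restrict G) ρ,
    Measure.rnDeriv_lt_top (Q.restrict Gᶜ) ρ, Measure.rnDeriv_lt_top T ρ] with z h1 h2 h3 h4 h5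
  rw [h1, h2, Pi.add_apply, Pi.add_apply, ENNReal.toReal_add h3.ne h5.ne,
    ENNReal.toReal_add h3.ne h4.ne]
  have hv : 0 ≤ ((Q.restrict Gᶜ).rnDeriv ρ z).toReal := ENNReal.toReal_nonneg
  have hu : 0 ≤ (T.rnDeriv ρ z).toReal := ENNReal.toReal_nonneg
  rw [abs_le]
  constructor <;> linarith

/-- Relocating the mass of `Q` on `{f > k + 2c}` to near-minimal points of `f` is
nearly optimal. -/
theorem penObj_restrict_add_le {ρ Q T : Measure Z} [SigmaFinite ρ] [IsProbabilityMeasure Q]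
    [IsFiniteMeasure T] (hQ : Q ≪ ρ) (hT : T ≪ ρ)
    {c C ε : ℝ} (hc : 0 ≤ c) (hε : 0 ≤ ε) {f k : Z → ℝ} (hf : Measurable f) (hk : Measurable k)
    (hfC : ∀ z, |f z| ≤ C) (hkC : ∀ z, |k z| ≤ C) {G : Set Z}
    (hG : G = {z | f z ≤ k z + 2 * c})
    (hTmass : T Set.univ = Q Gᶜ) (hTf : ∀ᵐ z ∂T, f z ≤ k z + ε)
    (hTk : ∫ z, k z ∂T = ∫ z in Gᶜ, k z ∂Q) :
    penObj ρ c f Q (Q.restrict G + T) ≤ ∫ z, min (f z) (k z + 2 * c) ∂Q + ε := by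
  have hGm : MeasurableSet G := hG ▸ measurableSet_le hf (hk.add_const _)
  have htv := tvDist_restrict_add_le hQ hT hGm
  have hmass : T.real Set.univ = Q.real Gᶜ := by simp [Measure.real, hTmass]
  have hone : Q.real Gᶜ ≤ 1 := measureReal_le_one
  have hfT : ∫ z, f z ∂T ≤ ∫ z, k z ∂T + T.real Set.univ * ε := by
    have := integral_mono_ae (integrable_of_abs_le (μ := T) hf hfC)
      ((integrable_of_abs_le (μ := T) hk hkC).add (integrable_const ε)) hTf
    rwa [integral_add' (integrable_of_abs_le hk hkC) (integrable_const _), integral_const,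
      smul_eq_mul] at this
  have hsplit := integral_add_compl hGm (μ := Q) (integrable_of_abs_le (measurable_min_add hf hk c)
    fun z => abs_min_add_le hc (hfC z) (hkC z))
  have hin : ∫ z in G, min (f z) (k z + 2 * c) ∂Q = ∫ z in G, f z ∂Q :=
    setIntegral_congr_fun hGm fun z hz => min_eq_left (by rw [hG] at hz; exact hz)
  have hout : ∫ z in Gᶜ, min (f z) (k z + 2 * c) ∂Q = ∫ z in Gᶜ, (k z + 2 * c) ∂Q :=
    setIntegral_congr_fun hGm.compl fun z hz => min_eq_right (by
      rw [hG] at hz; exact (not_le.1 (show ¬ f z ≤ k z + 2 * c from hz)).le)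
  rw [integral_add (integrable_of_abs_le hk hkC) (integrable_const _), setIntegral_const,
    smul_eq_mul] at hout
  rw [penObj, integral_add_measure (integrable_of_abs_le hf hfC) (integrable_of_abs_le hf hfC)]
  rw [hmass] at htv hfT
  nlinarith [mul_le_mul_of_nonneg_left htv hc, mul_le_mul_of_nonneg_right hone hε]

end Penalized

section EssInf

variable {X Y : Type*} [MeasurableSpace X] [MeasurableSpace Y]

theorem ae_essInf_le_of_abs_le {lam : Measure X} {f : X → ℝ} {C : ℝ} (hC : ∀ x, |f x| ≤ C) :
    ∀ᵐ x ∂lam, essInf f lam ≤ f x :=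
  ae_essInf_le ⟨-C, Filter.eventually_map.2 (ae_of_all _ fun x => (abs_le.1 (hC x)).1)⟩

theorem le_essInf_of_abs_le {lam : Measure X} [IsProbabilityMeasure lam] {f : X → ℝ} {C t : ℝ}
    (hC : ∀ x, |f x| ≤ C) (h : ∀ᵐ x ∂lam, t ≤ f x) : t ≤ essInf f lam :=
  le_essInf_of_ae_le t h (Filter.isCoboundedUnder_ge_of_le _ fun x => (abs_le.1 (hC x)).2)

theorem abs_essInf_le {lam : Measure X} [IsProbabilityMeasure lam] {f : X → ℝ} {C : ℝ}
    (hC : ∀ x, |f x| ≤ C) : |essInf f lam| ≤ C := by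
  obtain ⟨x, hx⟩ := (ae_essInf_le_of_abs_le (lam := lam) hC).exists
  exact abs_le.2 ⟨le_essInf_of_abs_le hC (ae_of_all _ fun x => (abs_le.1 (hC x)).1),
    hx.trans (abs_le.1 (hC x)).2⟩

theorem measurable_essInf_section {lam : Measure X} [IsProbabilityMeasure lam]
    {f : X × Y → ℝ} {C : ℝ} (hf : Measurable f) (hC : ∀ p, |f p| ≤ C) :
    Measurable fun y => essInf (fun x => f (x, y)) lam := by
  refine measurable_of_Ici fun t => ?_
  have : (fun y => essInf (fun x => f (x, y)) lam) ⁻¹' Set.Ici t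
      = (fun y => lam ((fun x => (x, y)) ⁻¹' {p | f p < t})) ⁻¹' {0} := by
    ext y
    have hy : lam ((fun x => (x, y)) ⁻¹' {p | f p < t}) = 0 ↔ ∀ᵐ x ∂lam, t ≤ f (x, y) := by
      simp [ae_iff, Set.preimage]
    simp only [Set.mem_preimage, Set.mem_Ici, Set.mem_singleton_iff, hy]
    exact ⟨fun h => (ae_essInf_le_of_abs_le fun x => hC (x, y)).mono fun x hx => h.trans hx,
      fun h => le_essInf_of_abs_le (fun x => hC (x, y)) h⟩
  rw [this]
  exact measurable_measure_prodMk_right (measurableSet_lt hf measurable_const)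
    (measurableSet_singleton 0)

/-- The pointwise integrand `min (f, essInf f + 2c)` of the optimal value. -/
def truncInf (lam : Measure X) (c : ℝ) (f : X × Y → ℝ) (p : X × Y) : ℝ :=
  min (f p) (essInf (fun x => f (x, p.2)) lam + 2 * c)

theorem measurable_truncInf {lam : Measure X} [IsProbabilityMeasure lam]
    {f : X × Y → ℝ} {c C : ℝ} (hf : Measurable f) (hC : ∀ p, |f p| ≤ C) :
    Measurable (truncInf lam c f) :=
  measurable_min_add hf ((measurable_essInf_section hf hC).comp measurable_snd) c

theorem abs_truncInf_le {Z : Type*} {lam : Measure X} [IsProbabilityMeasure lam]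
    {f : X × Z → ℝ} {c C : ℝ} (hc : 0 ≤ c) (hC : ∀ p, |f p| ≤ C) (p : X × Z) :
    |truncInf lam c f p| ≤ C :=
  abs_min_add_le hc (hC p) (abs_essInf_le fun x => hC (x, p.2))

theorem iInf_penObj_eq {lam psi : Measure X} [IsProbabilityMeasure lam] [IsProbabilityMeasure psi]
    (hpsi : psi ≪ lam) {c C : ℝ} (hc : 0 ≤ c) {f : X → ℝ} (hf : Measurable f)
    (hC : ∀ x, |f x| ≤ C) :
    ⨅ η : {η : Measure X // IsProbabilityMeasure η ∧ η ≪ lam}, penObj lam c f psi η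
      = ∫ x, min (f x) (essInf f lam + 2 * c) ∂psi := by
  set k := essInf f lam with hk
  have hkC : |k| ≤ C := abs_essInf_le hC
  have hlow : ∀ η : {η : Measure X // IsProbabilityMeasure η ∧ η ≪ lam},
      ∫ x, min (f x) (k + 2 * c) ∂psi ≤ penObj lam c f psi η := by
    rintro ⟨η, hη, hηac⟩
    exact integral_min_le_penObj (k := fun _ => k) hpsi hηac hc hf measurable_const hC
      (fun _ => hkC) (by simp) (ae_essInf_le_of_abs_le hC)
  have : Nonempty {η : Measure X // IsProbabilityMeasure η ∧ η ≪ lam} := ⟨⟨psi, ‹_›, hpsi⟩⟩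
  refine le_antisymm (le_of_forall_pos_le_add fun ε hε => ?_) (le_ciInf hlow)
  set B := {x | f x < k + ε} with hB
  have hBm : MeasurableSet B := measurableSet_lt hf measurable_const
  have hB0 : lam B ≠ 0 := by
    intro h0
    have : k + ε ≤ k := le_essInf_of_abs_le hC (by simpa [ae_iff] using h0)
    linarith
  have := cond_isProbabilityMeasure (μ := lam) hB0
  set G := {x | f x ≤ k + 2 * c} with hG
  have hGm : MeasurableSet G := measurableSet_le hf measurable_const
  set T : Measure X := psi Gᶜ • lam[|B]
  have : IsFiniteMeasure T := Measure.smul_finite _ (measure_ne_top _ _)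
  have hT : T ≪ lam := (Measure.smul_absolutelyContinuous).trans cond_absolutelyContinuous
  have hmass : T Set.univ = psi Gᶜ := by simp [T]
  have hle := penObj_restrict_add_le (k := fun _ => k) hpsi hT hc hε.le hf measurable_const hC
    (fun _ => hkC) hG hmass
    (Measure.ae_smul_measure ((ae_cond_mem hBm).mono fun x hx => le_of_lt hx) _)
    (by simp [Measure.real, hmass])
  have hprob : IsProbabilityMeasure (psi.restrict G + T) := ⟨by
    rw [Measure.add_apply, hmass, Measure.restrict_apply_univ, measure_add_measure_compl hGm,
      measure_univ]⟩
  have hac : psi.restrict G + T ≪ lam :=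
    Measure.AbsolutelyContinuous.add_left
      ((Measure.absolutelyContinuous_of_le Measure.restrict_le_self).trans hpsi) hT
  exact (ciInf_le ⟨_, Set.forall_mem_range.2 hlow⟩ ⟨_, hprob, hac⟩).trans hle

theorem ae_le_of_isMinimizer {lam psi η : Measure X} [IsProbabilityMeasure lam]
    [IsProbabilityMeasure psi] [IsProbabilityMeasure η]
    (hpsi : psi ≪ lam) (hη : η ≪ lam) {c C : ℝ} (hc : 0 ≤ c) {f : X → ℝ} (hf : Measurable f)
    (hC : ∀ x, |f x| ≤ C)
    (hmin : penObj lam c f psi η = ⨅ η : {η : Measure X // IsProbabilityMeasure η ∧ η ≪ lam},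
      penObj lam c f psi η)
    (h0 : lam {x | f x ≤ essInf f lam} = 0) :
    ∀ᵐ x ∂psi, f x ≤ essInf f lam + 2 * c := by
  rw [iInf_penObj_eq hpsi hc hf hC] at hmin
  exact ae_le_of_penObj_eq (k := fun _ => essInf f lam) hpsi hη hc hf measurable_const hC
    (fun _ => abs_essInf_le hC) (by simp) (by simpa [ae_iff] using h0) hmin

end EssInf

section Joint

variable {X Y : Type*} [MeasurableSpace X] [MeasurableSpace Y]

theorem measurable_map_prodMk {phi : Y → Measure X} (hphi : Measurable phi)
    (hprob : ∀ y, IsProbabilityMeasure (phi y)) :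
    Measurable fun y => (phi y).map fun x => (x, y) := by
  let κ : Kernel Y X := ⟨phi, hphi⟩
  have : IsMarkovKernel κ := ⟨hprob⟩
  refine Measure.measurable_of_measurable_coe _ fun S hS => ?_
  have h := Kernel.measurable_kernel_prodMk_left (κ := κ) (measurable_swap hS)
  convert h using 2 with y
  rw [Measure.map_apply (by fun_prop) hS]
  rfl

theorem mixJoint_apply {m : Measure Y} {phi : Y → Measure X} (hphi : Measurable phi)
    (hprob : ∀ y, IsProbabilityMeasure (phi y)) {S : Set (X × Y)} (hS : MeasurableSet S) :
    mixJoint m phi S = ∫⁻ y, phi y ((fun x => (x, y)) ⁻¹' S) ∂m := by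
  rw [mixJoint, Measure.bind_apply hS (measurable_map_prodMk hphi hprob).aemeasurable]
  exact lintegral_congr fun y => Measure.map_apply (by fun_prop) hS

theorem integral_mixJoint {m : Measure Y} [IsProbabilityMeasure m] {phi : Y → Measure X}
    (hphi : Measurable phi) (hprob : ∀ y, IsProbabilityMeasure (phi y)) {h : X × Y → ℝ} {C : ℝ}
    (hh : Measurable h) (hC : ∀ p, |h p| ≤ C) :
    ∫ p, h p ∂mixJoint m phi = ∫ y, ∫ x, h (x, y) ∂phi y ∂m := by
  let κ : Kernel Y X := ⟨phi, hphi⟩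
  have : IsMarkovKernel κ := ⟨hprob⟩
  have hmix : mixJoint m phi = (m ⊗ₘ κ).map Prod.swap := by
    ext S hS
    rw [mixJoint_apply hphi hprob hS, Measure.map_apply measurable_swap hS,
      Measure.compProd_apply (measurable_swap hS)]
    rfl
  rw [hmix, integral_map measurable_swap.aemeasurable hh.aestronglyMeasurable,
    Measure.integral_compProd (f := fun p : Y × X => h p.swap)
      (integrable_of_abs_le (hh.comp measurable_swap) fun p => hC _)]
  rfl

/-- The lower bound `∫ truncInf dQ` is attained among couplings with the `Y`-marginal of `Q`,
provided that excess mass of `Q` occurs only over points `y` where the essential infimum of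
`f(·, y)` is attained on a non-null set. -/
theorem exists_penObj_le {lam : Measure X} {nu : Measure Y} [IsProbabilityMeasure lam]
    [IsProbabilityMeasure nu] {Q : Measure (X × Y)} [IsProbabilityMeasure Q]
    (hQ : Q ≪ lam.prod nu) {c C : ℝ} (hc : 0 ≤ c) {f : X × Y → ℝ} (hf : Measurable f)
    (hC : ∀ p, |f p| ≤ C)
    (hnull : Q ({p | f p ≤ essInf (fun x => f (x, p.2)) lam + 2 * c}ᶜ ∩
      Prod.snd ⁻¹' {y | lam {x | f (x, y) ≤ essInf (fun x => f (x, y)) lam} = 0}) = 0) :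
    ∃ P : Measure (X × Y), (IsProbabilityMeasure P ∧ P ≪ lam.prod nu ∧
      P.map Prod.snd = Q.map Prod.snd) ∧
      penObj (lam.prod nu) c f Q P ≤ ∫ p, truncInf lam c f p ∂Q := by
  set k : Y → ℝ := fun y => essInf (fun x => f (x, y)) lam with hk
  have hkm : Measurable k := measurable_essInf_section hf hC
  have hkC : ∀ y, |k y| ≤ C := fun y => abs_essInf_le fun x => hC (x, y)
  set G := {p : X × Y | f p ≤ k p.2 + 2 * c} with hG
  have hGm : MeasurableSet G :=
    measurableSet_le hf ((hkm.comp measurable_snd).add_const _)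
  set B := {p : X × Y | f p ≤ k p.2} with hB
  have hBm : MeasurableSet B := measurableSet_le hf (hkm.comp measurable_snd)
  set b : Y → ℝ≥0∞ := fun y => lam ((fun x => (x, y)) ⁻¹' B) with hb
  have hbm : Measurable b := measurable_measure_prodMk_right hBm
  set τ : Measure Y := (Q.restrict Gᶜ).map Prod.snd with hτ
  have hτb : ∀ᵐ y ∂τ, b y ≠ 0 := by
    have hS : MeasurableSet {y | b y = 0} := hbm (measurableSet_singleton 0)
    have hset : {y | ¬b y ≠ 0} = {y | b y = 0} := by simp
    rw [ae_iff, hset, hτ, Measure.map_apply measurable_snd hS,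
      Measure.restrict_apply (measurable_snd hS), Set.inter_comm]
    exact hnull
  have hτnu : τ ≪ nu := by
    have h1 : τ ≪ (lam.prod nu).map Prod.snd :=
      ((Measure.absolutelyContinuous_of_le Measure.restrict_le_self).trans hQ).map measurable_snd
    rwa [Measure.map_snd_prod, measure_univ, one_smul] at h1
  set T : Measure (X × Y) :=
    (lam.prod τ).withDensity (B.indicator fun p => (b p.2)⁻¹) with hT
  have hTac : T ≪ lam.prod nu :=
    (withDensity_absolutelyContinuous _ _).trans
      (Measure.AbsolutelyContinuous.rfl.prod hτnu)
  have hdm : Measurable (B.indicator fun p : X × Y => (b p.2)⁻¹) :=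
    (hbm.comp measurable_snd).inv.indicator hBm
  have hTsnd : T.map Prod.snd = τ := by
    ext S hS
    rw [Measure.map_apply measurable_snd hS, hT, withDensity_apply _ (measurable_snd hS),
      ← lintegral_indicator (measurable_snd hS),
      lintegral_prod_symm _ (hdm.indicator (measurable_snd hS)).aemeasurable,
      ← setLIntegral_one, ← lintegral_indicator hS]
    refine lintegral_congr_ae ?_
    filter_upwards [hτb] with y hy
    by_cases hyS : y ∈ S
    · have : ∀ x, (Prod.snd ⁻¹' S).indicator (B.indicator fun p : X × Y => (b p.2)⁻¹) (x, y)
          = ((fun x => (x, y)) ⁻¹' B).indicator (fun _ => (b y)⁻¹) x := by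
        intro x
        rw [Set.indicator_of_mem (by exact hyS)]
        rfl
      simp only [this]
      rw [lintegral_indicator_const (by exact measurable_prodMk_right hBm)]
      simp only [hyS, Set.indicator_of_mem]
      exact ENNReal.inv_mul_cancel hy (measure_ne_top _ _)
    · simp [hyS]
  have hTmass : T Set.univ = Q Gᶜ := by
    have := congrArg (fun μ => μ Set.univ) hTsnd
    simpa [hτ, Measure.map_apply measurable_snd] using this
  have : IsFiniteMeasure T := ⟨by rw [hTmass]; exact measure_lt_top _ _⟩
  have hTf : ∀ᵐ p ∂T, f p ≤ k p.2 + 0 := by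
    rw [hT, ae_withDensity_iff hdm]
    refine ae_of_all _ fun p hp => ?_
    by_contra hcon
    exact hp (Set.indicator_of_notMem (by simpa [hB] using hcon) _)
  have hTk : ∫ p, k p.2 ∂T = ∫ p in Gᶜ, k p.2 ∂Q := by
    rw [← integral_map (φ := Prod.snd) (f := k) measurable_snd.aemeasurable
      hkm.aestronglyMeasurable, ← integral_map (φ := Prod.snd) (f := k)
      measurable_snd.aemeasurable hkm.aestronglyMeasurable, hTsnd]
  refine ⟨Q.restrict G + T, ⟨⟨?_⟩, ?_, ?_⟩, ?_⟩
  · rw [Measure.add_apply, hTmass, Measure.restrict_apply_univ, measure_add_measure_compl hGm,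
      measure_univ]
  · exact Measure.AbsolutelyContinuous.add_left
      ((Measure.absolutelyContinuous_of_le Measure.restrict_le_self).trans hQ) hTac
  · rw [Measure.map_add _ _ measurable_snd, hTsnd, hτ, ← Measure.map_add _ _ measurable_snd,
      Measure.restrict_add_restrict_compl hGm]
  · exact (penObj_restrict_add_le (k := fun p => k p.2) hQ hTac hc le_rfl hf
      (hkm.comp measurable_snd) hC (fun p => hkC p.2) hG hTmass hTf hTk).trans_eq (add_zero _)

/-- Attainment and interim representation for the penalized problem over couplings with the
`Y`-marginal of `Q`. -/
theorem exists_penObj_minimizer {lam : Measure X} {nu : Measure Y} [IsProbabilityMeasure lam]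
    [IsProbabilityMeasure nu] {Q : Measure (X × Y)} [IsProbabilityMeasure Q]
    (hQ : Q ≪ lam.prod nu) {phi : Y → Measure X} (hphi : Measurable phi)
    (hprob : ∀ y, IsProbabilityMeasure (phi y)) (hac : ∀ y, phi y ≪ lam)
    (hdis : Q = mixJoint (Q.map Prod.snd) phi)
    {c C : ℝ} (hc : 0 ≤ c) {f : X × Y → ℝ} (hf : Measurable f) (hC : ∀ p, |f p| ≤ C)
    (hsol : ∀ y, ∃ η : Measure X, IsProbabilityMeasure η ∧ η ≪ lam ∧
      penObj lam c (fun x => f (x, y)) (phi y) η =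
        ⨅ η : {η : Measure X // IsProbabilityMeasure η ∧ η ≪ lam},
          penObj lam c (fun x => f (x, y)) (phi y) η)
    {V : ℝ} (hVdef : V = ⨅ P : {P : Measure (X × Y) // IsProbabilityMeasure P ∧ P ≪ lam.prod nu ∧
      P.map Prod.snd = Q.map Prod.snd}, penObj (lam.prod nu) c f Q P) :
    (∃ P : Measure (X × Y), (IsProbabilityMeasure P ∧ P ≪ lam.prod nu ∧
      P.map Prod.snd = Q.map Prod.snd) ∧ penObj (lam.prod nu) c f Q P = V) ∧
    V = ∫ y, (⨅ η : {η : Measure X // IsProbabilityMeasure η ∧ η ≪ lam},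
          penObj lam c (fun x => f (x, y)) (phi y) η) ∂(Q.map Prod.snd) ∧
    V = ∫ p, truncInf lam c f p ∂Q := by
  have hfy : ∀ y, Measurable fun x => f (x, y) := fun y => hf.comp measurable_prodMk_right
  have hkm := measurable_essInf_section (lam := lam) hf hC
  have : IsProbabilityMeasure (Q.map Prod.snd) :=
    Measure.isProbabilityMeasure_map measurable_snd.aemeasurable
  have hnull : Q ({p | f p ≤ essInf (fun x => f (x, p.2)) lam + 2 * c}ᶜ ∩
      Prod.snd ⁻¹' {y | lam {x | f (x, y) ≤ essInf (fun x => f (x, y)) lam} = 0}) = 0 := by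
    have hm : MeasurableSet {y | lam {x | f (x, y) ≤ essInf (fun x => f (x, y)) lam} = 0} :=
      measurable_measure_prodMk_right (μ := lam)
        (measurableSet_le hf (hkm.comp measurable_snd)) (measurableSet_singleton 0)
    have hG : MeasurableSet {p | f p ≤ essInf (fun x => f (x, p.2)) lam + 2 * c} :=
      measurableSet_le hf ((hkm.comp measurable_snd).add_const _)
    rw [hdis, mixJoint_apply hphi hprob (hG.compl.inter (measurable_snd hm))]
    refine (lintegral_congr (g := fun _ => 0) fun y => ?_).trans lintegral_zero
    by_cases hy : lam {x | f (x, y) ≤ essInf (fun x => f (x, y)) lam} = 0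
    · obtain ⟨η, hη, hηac, hmin⟩ := hsol y
      have := hprob y
      exact measure_mono_null Set.inter_subset_left
        (ae_le_of_isMinimizer (hac y) hηac hc (hfy y) (fun x => hC (x, y)) hmin hy)
    · refine measure_mono_null (t := ∅) (fun x hx => hy hx.2) measure_empty
  obtain ⟨P, hP, hle⟩ := exists_penObj_le hQ hc hf hC hnull
  have hlow : ∀ P : {P : Measure (X × Y) // IsProbabilityMeasure P ∧ P ≪ lam.prod nu ∧
      P.map Prod.snd = Q.map Prod.snd},
      ∫ p, truncInf lam c f p ∂Q ≤ penObj (lam.prod nu) c f Q P := by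
    rintro ⟨P, hP1, hP2, hP3⟩
    refine integral_min_le_penObj (k := fun p => essInf (fun x => f (x, p.2)) lam)
      hQ hP2 hc hf (hkm.comp measurable_snd) hC
      (fun p => abs_essInf_le fun x => hC (x, p.2)) ?_ ?_
    · rw [← integral_map (φ := Prod.snd) (f := fun y => essInf (fun x => f (x, y)) lam)
        measurable_snd.aemeasurable hkm.aestronglyMeasurable, hP3,
        integral_map measurable_snd.aemeasurable hkm.aestronglyMeasurable]
    · have hS := (measurableSet_le (hkm.comp measurable_snd) hf : MeasurableSet
        {p : X × Y | essInf (fun x => f (x, p.2)) lam ≤ f p})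
      change lam.prod nu {p : X × Y | essInf (fun x => f (x, p.2)) lam ≤ f p}ᶜ = 0
      rw [Measure.prod_apply_symm hS.compl]
      refine (lintegral_congr (g := fun _ => 0) fun y => ?_).trans lintegral_zero
      exact ae_iff.1 (ae_essInf_le_of_abs_le (lam := lam) (f := fun x => f (x, y))
        fun x => hC (x, y))
  have : Nonempty {P : Measure (X × Y) // IsProbabilityMeasure P ∧ P ≪ lam.prod nu ∧
      P.map Prod.snd = Q.map Prod.snd} := ⟨⟨P, hP⟩⟩
  have hV : V = ∫ p, truncInf lam c f p ∂Q :=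
    hVdef.trans (le_antisymm
      ((ciInf_le ⟨_, Set.forall_mem_range.2 hlow⟩ ⟨P, hP⟩).trans hle) (le_ciInf hlow))
  refine ⟨⟨P, hP, (le_antisymm hle (hlow ⟨P, hP⟩)).trans hV.symm⟩, ?_, hV⟩
  rw [hV]
  conv_lhs => rw [hdis]
  rw [integral_mixJoint hphi hprob (measurable_truncInf hf hC) (abs_truncInf_le hc hC)]
  refine integral_congr_ae (ae_of_all _ fun y => ?_)
  have := hprob y
  exact (iInf_penObj_eq (hac y) hc (hfy y) fun x => hC (x, y)).symm

end Joint

section Manipulation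

variable {X Y A : Type*} [MeasurableSpace X] [MeasurableSpace Y] [MeasurableSpace A]

namespace ManipSetting

/-- Discounted manipulation cost plus continuation value when `j` stages remain. -/
def stageCost (M : ManipSetting X Y A) (j : ℕ) (p : X × Y) : ℝ :=
  M.alpha ^ (M.N - j) * M.r p.1 p.2 (M.g (M.N - j) p.1)
    + M.Wrec (j - 1) p.1 p.2 (M.g (M.N - j) p.1)

/-- `W_j` is jointly measurable and bounded. -/
def WrecRegular (M : ManipSetting X Y A) (j : ℕ) : Prop :=
  (Measurable fun p : X × Y × A => M.Wrec j p.1 p.2.1 p.2.2) ∧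
    ∃ C : ℝ, ∀ x y a, |M.Wrec j x y a| ≤ C

end ManipSetting

variable {M : ManipSetting X Y A}

theorem measurable_graph (hM : ManipHyps M) (n : ℕ) :
    Measurable fun p : X × Y => (p.1, p.2, M.g n p.1) :=
  measurable_fst.prodMk (measurable_snd.prodMk ((hM.g_meas n).comp measurable_fst))

theorem abs_r_le (hM : ManipHyps M) {C : ℝ} (hC : ∀ x y a, M.r x y a ≤ C) (x : X) (y : Y) (a : A) :
    |M.r x y a| ≤ C := by
  rw [abs_of_nonneg (hM.r_nonneg x y a)]
  exact hC x y a

theorem stageCost_regular (hM : ManipHyps M) {j : ℕ} (hW : M.WrecRegular (j - 1)) :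
    Measurable (M.stageCost j) ∧ ∃ C, ∀ p, |M.stageCost j p| ≤ C := by
  obtain ⟨hWm, C, hC⟩ := hW
  obtain ⟨D, hD⟩ := hM.r_bdd
  have hg := measurable_graph hM (M.N - j)
  refine ⟨((hM.r_meas.comp hg).const_mul _).add (hWm.comp hg),
    M.alpha ^ (M.N - j) * D + C, fun p => ?_⟩
  refine (abs_add_le _ _).trans (add_le_add ?_ (hC _ _ _))
  rw [abs_mul, abs_of_pos (pow_pos hM.alpha_pos _)]
  exact mul_le_mul_of_nonneg_left (abs_r_le hM hD _ _ _) (pow_pos hM.alpha_pos _).le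

/-- Integrated stage costs split into manipulation cost and continuation value; `e` embeds the
integration variable in `X × Y`. -/
theorem penObj_stageCost (hM : ManipHyps M) {j : ℕ} (hW : M.WrecRegular (j - 1))
    {Z : Type*} [MeasurableSpace Z] {e : Z → X × Y} (he : Measurable e) (ρ Q P : Measure Z)
    [IsProbabilityMeasure P] :
    penObj ρ (M.alpha ^ (M.N - j)) (fun z => M.stageCost j (e z)) Q P
      = M.alpha ^ (M.N - j) * ((∫ z, M.r (e z).1 (e z).2 (M.g (M.N - j) (e z).1) ∂P)
          + tvDist ρ P Q)
        + ∫ z, M.Wrec (j - 1) (e z).1 (e z).2 (M.g (M.N - j) (e z).1) ∂P := by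
  obtain ⟨hWm, C, hC⟩ := hW
  obtain ⟨D, hD⟩ := hM.r_bdd
  have hg := (measurable_graph hM (M.N - j)).comp he
  have i1 : Integrable (fun z => M.r (e z).1 (e z).2 (M.g (M.N - j) (e z).1)) P :=
    integrable_of_abs_le (hM.r_meas.comp hg) fun z => abs_r_le hM hD _ _ _
  have i2 : Integrable (fun z => M.Wrec (j - 1) (e z).1 (e z).2 (M.g (M.N - j) (e z).1)) P :=
    integrable_of_abs_le (hWm.comp hg) fun z => hC _ _ _
  simp only [penObj, ManipSetting.stageCost]
  rw [integral_add (i1.const_mul _) i2, integral_const_mul]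
  ring

theorem isProbabilityMeasure_Qm (hM : ManipHyps M) (x : X) (y : Y) (a : A) :
    IsProbabilityMeasure (M.Qm x y a) :=
  ⟨by rw [ManipSetting.Qm, withDensity_apply _ MeasurableSet.univ, Measure.restrict_univ,
    hM.q_dens]⟩

theorem isProbabilityMeasure_Q0m (hM : ManipHyps M) : IsProbabilityMeasure M.Q0m :=
  ⟨by rw [ManipSetting.Q0m, withDensity_apply _ MeasurableSet.univ, Measure.restrict_univ,
    hM.q0_dens]⟩

theorem stage_attained_and_representation (hM : ManipHyps M) {ψ : X → Y → A → Y → Measure X}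
    {ψ0 : Y → Measure X} (hdis : DisintHyps M ψ ψ0) {j : ℕ} (hj : 1 ≤ j)
    (hW : M.WrecRegular (j - 1)) (x : X) (y : Y) (a : A)
    (hsol : ∀ y', (interimSolSet M ψ j y' x y a).Nonempty) :
    (∃ P : Measure (X × Y), M.Feas x y a P ∧ M.stageObj j x y a P = M.Wrec j x y a)
      ∧ M.Wrec j x y a = ∫ y', M.WYval ψ j y' x y a ∂(M.QY x y a)
      ∧ M.Wrec j x y a = ∫ p, truncInf M.lam (M.alpha ^ (M.N - j)) (M.stageCost j) p
          ∂(M.Qm x y a) := by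
  have := hM.lam_prob
  have := hM.nu_prob
  have := isProbabilityMeasure_Qm hM x y a
  obtain ⟨hfm, C, hC⟩ := stageCost_regular hM hW
  have hobj (P : Measure (X × Y)) [IsProbabilityMeasure P] :
      penObj (M.lam.prod M.nu) (M.alpha ^ (M.N - j)) (M.stageCost j) (M.Qm x y a) P
        = M.stageObj j x y a P := penObj_stageCost hM hW measurable_id _ _ P
  have hobjY (y' : Y) (η : Measure X) [IsProbabilityMeasure η] :
      penObj M.lam (M.alpha ^ (M.N - j)) (fun x' => M.stageCost j (x', y')) (ψ x y a y') η
        = M.interimObj ψ j y' x y a η := penObj_stageCost hM hW measurable_prodMk_right _ _ η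
  have hWY (y' : Y) : ⨅ η : {η : Measure X // IsProbabilityMeasure η ∧ η ≪ M.lam},
      penObj M.lam (M.alpha ^ (M.N - j)) (fun x' => M.stageCost j (x', y')) (ψ x y a y') η
        = M.WYval ψ j y' x y a :=
    iInf_congr fun η => have := η.2.1; hobjY y' η
  have hV : M.Wrec j x y a = ⨅ P : {P : Measure (X × Y) // IsProbabilityMeasure P ∧
      P ≪ M.lam.prod M.nu ∧ P.map Prod.snd = (M.Qm x y a).map Prod.snd},
      penObj (M.lam.prod M.nu) (M.alpha ^ (M.N - j)) (M.stageCost j) (M.Qm x y a) P := by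
    obtain ⟨i, rfl⟩ := Nat.exists_eq_add_of_le' hj
    rw [ManipSetting.Wrec]
    exact iInf_congr fun P => have := P.2.1; (hobj P).symm
  obtain ⟨⟨P, hP, hPV⟩, hrep, htr⟩ := exists_penObj_minimizer
    (show M.Qm x y a ≪ M.lam.prod M.nu from withDensity_absolutelyContinuous _ _)
    (hdis.ψ_meas x y a)
    (hdis.ψ_prob x y a) (hdis.ψ_ac x y a) (hdis.ψ_dis x y a) (pow_pos hM.alpha_pos _).le hfm hC
    (fun y' => by
      obtain ⟨η, hη, hmin⟩ := hsol y'
      exact ⟨η, inferInstance, hη, (hobjY y' η).trans (hmin.trans (hWY y').symm)⟩) hV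
  have := hP.1
  refine ⟨⟨P, hP, (hobj P).symm.trans hPV⟩, ?_, htr⟩
  rw [hrep]
  exact integral_congr_ae (ae_of_all _ hWY)

theorem stage0_attained_and_representation (hM : ManipHyps M) {ψ : X → Y → A → Y → Measure X}
    {ψ0 : Y → Measure X} (hdis : DisintHyps M ψ ψ0) (hW : M.WrecRegular (M.N - 1))
    (hsol : ∀ y, (interim0SolSet M ψ0 y).Nonempty) :
    (∃ P : Measure (X × Y), M.Feas0 P ∧ M.stage0Obj P = M.WNval)
      ∧ M.WNval = ∫ y, M.WY0val ψ0 y ∂M.Q0Y := by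
  have := hM.lam_prob
  have := hM.nu_prob
  have := isProbabilityMeasure_Q0m hM
  obtain ⟨hfm, C, hC⟩ := stageCost_regular hM hW
  have hobj (P : Measure (X × Y)) [IsProbabilityMeasure P] :
      penObj (M.lam.prod M.nu) 1 (M.stageCost M.N) M.Q0m P = M.stage0Obj P := by
    simpa [ManipSetting.stage0Obj] using penObj_stageCost hM hW measurable_id _ M.Q0m P
  have hobjY (y : Y) (η : Measure X) [IsProbabilityMeasure η] :
      penObj M.lam 1 (fun x' => M.stageCost M.N (x', y)) (ψ0 y) η = M.interim0Obj ψ0 y η := by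
    simpa [ManipSetting.interim0Obj] using
      penObj_stageCost hM hW measurable_prodMk_right M.lam (ψ0 y) η
  have hWY (y : Y) : ⨅ η : {η : Measure X // IsProbabilityMeasure η ∧ η ≪ M.lam},
      penObj M.lam 1 (fun x' => M.stageCost M.N (x', y)) (ψ0 y) η = M.WY0val ψ0 y :=
    iInf_congr fun η => have := η.2.1; hobjY y η
  have hV : M.WNval = ⨅ P : {P : Measure (X × Y) // IsProbabilityMeasure P ∧
      P ≪ M.lam.prod M.nu ∧ P.map Prod.snd = M.Q0m.map Prod.snd},
      penObj (M.lam.prod M.nu) 1 (M.stageCost M.N) M.Q0m P :=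
    iInf_congr fun P => have := P.2.1; (hobj P).symm
  obtain ⟨⟨P, hP, hPV⟩, hrep, -⟩ := exists_penObj_minimizer
    (show M.Q0m ≪ M.lam.prod M.nu from withDensity_absolutelyContinuous _ _)
    hdis.ψ0_meas hdis.ψ0_prob hdis.ψ0_ac hdis.ψ0_dis
    zero_le_one hfm hC
    (fun y => by
      obtain ⟨η, hη, hmin⟩ := hsol y
      exact ⟨η, inferInstance, hη, (hobjY y η).trans (hmin.trans (hWY y).symm)⟩) hV
  have := hP.1
  refine ⟨⟨P, hP, (hobj P).symm.trans hPV⟩, ?_⟩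
  rw [hrep]
  exact integral_congr_ae (ae_of_all _ hWY)

theorem measurable_integral_Qm (hM : ManipHyps M) {h : X × Y → ℝ} (hh : Measurable h) :
    Measurable fun s : X × Y × A => ∫ p, h p ∂(M.Qm s.1 s.2.1 s.2.2) := by
  have := hM.lam_prob
  have := hM.nu_prob
  have hq : Measurable fun t : (X × Y × A) × (X × Y) =>
      M.q t.2.1 t.2.2 t.1.1 t.1.2.1 t.1.2.2 :=
    hM.q_meas.comp (g := fun p : X × Y × X × Y × A =>
      M.q p.1 p.2.1 p.2.2.1 p.2.2.2.1 p.2.2.2.2)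
      (f := fun t : (X × Y × A) × (X × Y) => (t.2.1, t.2.2, t.1.1, t.1.2.1, t.1.2.2))
      (by fun_prop)
  have hI : Measurable fun t : (X × Y × A) × (X × Y) =>
      (ENNReal.ofReal (M.q t.2.1 t.2.2 t.1.1 t.1.2.1 t.1.2.2)).toReal * h t.2 :=
    hq.ennreal_ofReal.ennreal_toReal.mul (hh.comp measurable_snd)
  convert (hI.stronglyMeasurable.integral_prod_right' (ν := M.lam.prod M.nu)).measurable
    using 2 with s
  have hqs : Measurable fun p : X × Y => ENNReal.ofReal (M.q p.1 p.2 s.1 s.2.1 s.2.2) :=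
    (hq.comp (measurable_prodMk_left (x := s))).ennreal_ofReal
  exact integral_withDensity_eq_integral_toReal_smul hqs
    (ae_of_all _ fun _ => ENNReal.ofReal_lt_top) h

theorem wrecRegular (hM : ManipHyps M) {ψ : X → Y → A → Y → Measure X}
    {ψ0 : Y → Measure X} (hdis : DisintHyps M ψ ψ0)
    (hsol : ∀ j x y a y', 1 ≤ j → j ≤ M.N - 1 → (interimSolSet M ψ j y' x y a).Nonempty)
    (j : ℕ) (hj : j ≤ M.N - 1) : M.WrecRegular j := by
  induction j with
  | zero => exact ⟨by simpa only [ManipSetting.Wrec] using measurable_const, 0, by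
      simp [ManipSetting.Wrec]⟩
  | succ i ih =>
    have hW := ih (by omega)
    have := hM.lam_prob
    obtain ⟨hfm, C, hC⟩ := stageCost_regular (j := i + 1) hM hW
    have hrep (x : X) (y : Y) (a : A) := (stage_attained_and_representation hM hdis
      (Nat.le_add_left 1 i) hW x y a fun y' => hsol _ x y a y' (Nat.le_add_left 1 i) hj).2.2
    refine ⟨?_, C, fun x y a => ?_⟩
    · simp only [hrep]
      exact measurable_integral_Qm hM (measurable_truncInf hfm hC)
    · have := isProbabilityMeasure_Qm hM x y a
      rw [hrep]
      exact abs_integral_le_of_abs_le (abs_truncInf_le (pow_pos hM.alpha_pos _).le hC)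

end Manipulation

/-- existence and interim representation for the manipulator's backward
recursion; core of Theorem 3: if all interim solution sets are nonempty and compact in the
weak topology, then for each `n = N−1,…,1` (i.e. each recursion index `j = N−n ∈ {1,…,N−1}`)
and each `(x,y,a)` the infimum defining `W_{N−n}(x,y,a)` over stagewise consistent `P` is
attained and `W_{N−n}(x,y,a) = ∫_Y W^Y_{N−n}(y'; x,y,a) Q^Y(dy'|x,y,a)`; likewise the
infimum defining `W_N` is attained and `W_N = ∫_Y W^Y_N(y; Q_0) Q_0^Y(dy)`. -/
theorem manipulator_backward_recursion {X Y A : Type*}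
    [MeasurableSpace X] [TopologicalSpace X] [OpensMeasurableSpace X]
    [MeasurableSpace Y] [MeasurableSpace A]
    (M : ManipSetting X Y A) (hM : ManipHyps M)
    (ψ : X → Y → A → Y → Measure X) (ψ0 : Y → Measure X) (hdis : DisintHyps M ψ ψ0)
    (hsol : ∀ j x y a y', 1 ≤ j → j ≤ M.N - 1 →
        (interimSolSet M ψ j y' x y a).Nonempty ∧ IsCompact (interimSolSet M ψ j y' x y a))
    (hsol0 : ∀ y, (interim0SolSet M ψ0 y).Nonempty ∧ IsCompact (interim0SolSet M ψ0 y)) :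
    (∀ j, 1 ≤ j → j ≤ M.N - 1 → ∀ (x : X) (y : Y) (a : A),
        (∃ P : Measure (X × Y), M.Feas x y a P ∧ M.stageObj j x y a P = M.Wrec j x y a)
          ∧ M.Wrec j x y a = ∫ y', M.WYval ψ j y' x y a ∂(M.QY x y a))
      ∧ (∃ P0 : Measure (X × Y), M.Feas0 P0 ∧ M.stage0Obj P0 = M.WNval)
      ∧ M.WNval = ∫ y, M.WY0val ψ0 y ∂M.Q0Y := by
  have hreg := wrecRegular hM hdis fun j x y a y' h1 h2 => (hsol j x y a y' h1 h2).1
  refine ⟨fun j h1 h2 x y a => ?_,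
    stage0_attained_and_representation hM hdis (hreg _ le_rfl) fun y => (hsol0 y).1⟩
  obtain ⟨hatt, hrep, -⟩ := stage_attained_and_representation hM hdis h1
    (hreg (j - 1) (by omega)) x y a fun y' => (hsol j x y a y' h1 h2).1
  exact ⟨hatt, hrep⟩

end DIMG
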